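/- For every integer t ≥ 1 and every integer n ≥ 14t+6, every 2-edge-colouring of K_n with min{|R|,|B|} > (4t+1)·n^{1+1/(4t+2)} + 16(4t+1)·n contains a balanced copy of 2C_{4t+2}, i.e. a copy of the vertex-disjoint union of two cycles of length 4t+2 having exactly 4t+2 red edges and 4t+2 blue edges; in particular 2C_{4t+2} is balanceable and bal(n, 2C_{4t+2}) ≤ (4t+1)·n^{1+1/(4t+2)} + 16(4t+1)·n for n ≥ 14t+6. -/

import Mathlib

/-- The set of red edges of a 2-edge-colouring of `K_n`
    (`true` = red, `false` = blue). -/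
def redEdges (n : ℕ) (c : Sym2 (Fin n) → Bool) : Finset (Sym2 (Fin n)) :=
  (⊤ : SimpleGraph (Fin n)).edgeFinset.filter (fun e => c e = true)

/-- The set of blue edges of a 2-edge-colouring of `K_n`. -/
def blueEdges (n : ℕ) (c : Sym2 (Fin n) → Bool) : Finset (Sym2 (Fin n)) :=
  (⊤ : SimpleGraph (Fin n)).edgeFinset.filter (fun e => c e = false)

/-- The number of red edges of the copy of the cycle `C_m` in `K_n` determined by an
injective map `f : Fin m → Fin n` (with edges `f i — f (i+1)`, indices mod `m`). -/
def cycleRedCount (n m : ℕ) (hm : 1 < m) (c : Sym2 (Fin n) → Bool)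
    (f : Fin m → Fin n) : ℕ :=
  (Finset.univ.filter fun i : Fin m => c s(f i, f (i + ⟨1, hm⟩)) = true).card

/-- The indicator, as an integer, of the pair `u, v` being red. -/
def redInd {V : Type*} (c : Sym2 V → Bool) (u v : V) : ℤ :=
  if c s(u, v) = true then 1 else 0

lemma redInd_comm {V : Type*} (c : Sym2 V → Bool) (u v : V) : redInd c u v = redInd c v u := by
  simp only [redInd, Sym2.eq_swap]

lemma redInd_nonneg {V : Type*} (c : Sym2 V → Bool) (u v : V) : 0 ≤ redInd c u v := by
  unfold redInd; split_ifs <;> simp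

lemma redInd_le_one {V : Type*} (c : Sym2 V → Bool) (u v : V) : redInd c u v ≤ 1 := by
  unfold redInd; split_ifs <;> simp

lemma redInd_not {V : Type*} (c : Sym2 V → Bool) (u v : V) :
    redInd (fun e => !c e) u v = 1 - redInd c u v := by
  unfold redInd; cases h : c s(u, v) <;> simp [h]

/-- The number of red edges among the pairs `h i, h (σ i)`. -/
def redSum {ι V : Type*} [Fintype ι] (c : Sym2 V → Bool) (σ : Equiv.Perm ι) (h : ι → V) : ℤ :=
  ∑ i, redInd c (h i) (h (σ i))

lemma redSum_update {ι V : Type*} [Fintype ι] [DecidableEq ι] (c : Sym2 V → Bool)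
    (σ : Equiv.Perm ι) (h : ι → V) (j : ι) (hj : σ j ≠ j) (v : V) :
    redSum c σ (Function.update h j v) = redSum c σ h
      + (redInd c v (h (σ j)) + redInd c v (h (σ.symm j)))
      - (redInd c (h j) (h (σ j)) + redInd c (h j) (h (σ.symm j))) := by
  have hj' : σ.symm j ≠ j := fun e => hj (by simpa using (congrArg σ e).symm)
  have key : ∑ i, (redInd c (Function.update h j v i) (Function.update h j v (σ i))
      - redInd c (h i) (h (σ i))) =
      (redInd c v (h (σ j)) - redInd c (h j) (h (σ j))) +
      (redInd c v (h (σ.symm j)) - redInd c (h j) (h (σ.symm j))) := by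
    rw [Fintype.sum_eq_add j (σ.symm j) hj'.symm]
    · simp only [Function.update_self, Function.update_of_ne hj, Function.update_of_ne hj',
        Equiv.apply_symm_apply]
      rw [redInd_comm c (h (σ.symm j)) v, redInd_comm c (h (σ.symm j)) (h j)]
    · rintro i ⟨h1, h2⟩
      have h3 : σ i ≠ j := fun e => h2 (by rw [← e]; simp)
      simp [Function.update_of_ne h1, Function.update_of_ne h3]
  rw [Finset.sum_sub_distrib] at key
  unfold redSum
  linarith

lemma redSum_not {ι V : Type*} [Fintype ι] (c : Sym2 V → Bool) (σ : Equiv.Perm ι) (h : ι → V) :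
    redSum (fun e => !c e) σ h = Fintype.card ι - redSum c σ h := by
  simp [redSum, redInd_not]

lemma card_le_redSum {ι V : Type*} [Fintype ι] (c : Sym2 V → Bool) (σ : Equiv.Perm ι)
    (h : ι → V) (s : Finset ι) (hs : ∀ i ∈ s, c s(h i, h (σ i)) = true) :
    (s.card : ℤ) ≤ redSum c σ h := by
  calc (s.card : ℤ) = ∑ i ∈ s, redInd c (h i) (h (σ i)) := by
        rw [Finset.sum_congr rfl (g := fun _ => (1 : ℤ))]
        · simp
        · intro i hi; simp [redInd, hs i hi]
    _ ≤ _ := Finset.sum_le_sum_of_subset_of_nonneg (Finset.subset_univ _)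
        fun i _ _ => redInd_nonneg _ _ _

lemma injective_piecewise {ι V : Type*} [DecidableEq ι] {h h' : ι → V}
    (hh : Function.Injective h) (hh' : Function.Injective h')
    (hd : ∀ i j, h i = h' j → i = j) (T : Finset ι) :
    Function.Injective (T.piecewise h' h) := by
  intro i j e
  by_cases hi : i ∈ T <;> by_cases hj : j ∈ T <;> simp [hi, hj] at e
  · exact hh' e
  · exact (hd _ _ e.symm).symm
  · exact hd _ _ e
  · exact hh e

/-- Exchanging vertices one at a time, the number of red edges moves in steps of at most two. -/
lemma exists_piecewise_redSum {ι V : Type*} [Fintype ι] [DecidableEq ι] (c : Sym2 V → Bool)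
    (σ : Equiv.Perm ι) (hσ : ∀ i, σ i ≠ i) (h h' : ι → V) (k : ℤ)
    (h1 : redSum c σ h ≤ k) (h2 : k ≤ redSum c σ h') :
    ∃ T : Finset ι, redSum c σ (T.piecewise h' h) = k ∨
      redSum c σ (T.piecewise h' h) = k - 1 := by
  by_contra! hcon
  have key : ∀ T : Finset ι, redSum c σ (T.piecewise h' h) ≤ k - 2 := by
    intro T
    induction T using Finset.induction_on with
    | empty =>
      have := hcon ∅
      simp only [Finset.piecewise_empty] at this ⊢
      omega
    | insert j T hj ih =>
      have h3 := hcon (insert j T)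
      rw [Finset.piecewise_insert, redSum_update c σ _ j (hσ j)] at h3 ⊢
      set g := T.piecewise h' h
      have a1 := redInd_le_one c (h' j) (g (σ j))
      have a2 := redInd_le_one c (h' j) (g (σ.symm j))
      have a3 := redInd_nonneg c (g j) (g (σ j))
      have a4 := redInd_nonneg c (g j) (g (σ.symm j))
      omega
  have := key Finset.univ
  simp only [Finset.piecewise_univ] at this
  omega

/-- If every 4-cycle has an even number of red edges, then disjoint copies of the same
2-regular graph have the same parity of red edges. -/
lemma even_redSum_sub {ι V : Type*} [Fintype ι] [DecidableEq ι] (c : Sym2 V → Bool)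
    (σ : Equiv.Perm ι) (hσ : ∀ i, σ i ≠ i)
    (hev : ∀ a b x y : V, x ≠ a → x ≠ b → y ≠ a → y ≠ b →
      Even ((redInd c y a + redInd c y b) - (redInd c x a + redInd c x b)))
    (f g : ι → V) (hf : Function.Injective f) (hg : Function.Injective g)
    (hd : ∀ i j, f i ≠ g j) : Even (redSum c σ g - redSum c σ f) := by
  have inj := injective_piecewise hf hg fun i j e => (hd i j e).elim
  have key : ∀ T : Finset ι, Even (redSum c σ (T.piecewise g f) - redSum c σ f) := by
    intro T
    induction T using Finset.induction_on with
    | empty => simp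
    | insert j T hj ih =>
      have hσ' : σ.symm j ≠ j := fun e => hσ j (by simpa using (congrArg σ e).symm)
      have i1 := inj T
      have i2 := inj (insert j T)
      rw [Finset.piecewise_insert] at i2 ⊢
      rw [redSum_update c σ _ j (hσ j)]
      set w := T.piecewise g f
      have n1 : g j ≠ w (σ j) := by
        have := i2.ne (hσ j).symm
        rwa [Function.update_self, Function.update_of_ne (hσ j)] at this
      have n2 : g j ≠ w (σ.symm j) := by
        have := i2.ne hσ'.symm
        rwa [Function.update_self, Function.update_of_ne hσ'] at this
      obtain ⟨p, hp⟩ := ih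
      obtain ⟨q, hq⟩ := hev (w (σ j)) (w (σ.symm j)) (w j) (g j) (i1.ne (hσ j).symm) (i1.ne hσ'.symm) n1 n2
      exact ⟨p + q, by linarith⟩
  simpa using key Finset.univ

/-- Twice the number of edges of `G` inside `W`. -/
def inducedDartCount {V : Type*} [DecidableEq V] (G : SimpleGraph V) [DecidableRel G.Adj]
    (W : Finset V) : ℕ :=
  ∑ u ∈ W, (W.filter (G.Adj u)).card

lemma inducedDartCount_le_erase {V : Type*} [DecidableEq V] (G : SimpleGraph V)
    [DecidableRel G.Adj] (W : Finset V) (v : V) (hv : v ∈ W) :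
    inducedDartCount G W ≤ inducedDartCount G (W.erase v) + 2 * (W.filter (G.Adj v)).card := by
  unfold inducedDartCount
  rw [← Finset.add_sum_erase W _ hv]
  have h1 : ∀ u ∈ W.erase v, (W.filter (G.Adj u)).card =
      ((W.erase v).filter (G.Adj u)).card + if G.Adj v u then 1 else 0 := by
    intro u hu
    rw [Finset.filter_erase]
    split_ifs with ha
    · rw [Finset.card_erase_add_one]
      simp [hv, ha.symm]
    · rw [Finset.erase_eq_of_notMem]
      · simp
      · simp [hv, G.adj_comm u v, ha]
  rw [Finset.sum_congr rfl h1, Finset.sum_add_distrib]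
  have h2 : (∑ u ∈ W.erase v, if G.Adj v u then 1 else 0) ≤ (W.filter (G.Adj v)).card := by
    rw [← Finset.card_filter]
    exact Finset.card_le_card (Finset.filter_subset_filter _ (Finset.erase_subset _ _))
  omega

lemma inducedDartCount_le_sdiff {n : ℕ} (G : SimpleGraph (Fin n)) [DecidableRel G.Adj]
    (W S : Finset (Fin n)) :
    inducedDartCount G W ≤ inducedDartCount G (W \ S) + 2 * n * S.card := by
  induction S using Finset.induction_on with
  | empty => simp
  | insert v S hv ih =>
    rw [Finset.card_insert_of_notMem hv, Finset.sdiff_insert]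
    by_cases hw : v ∈ W \ S
    · have := inducedDartCount_le_erase G (W \ S) v hw
      have h2 : ((W \ S).filter (G.Adj v)).card ≤ n := by
        simpa using Finset.card_le_univ ((W \ S).filter (G.Adj v))
      nlinarith
    · rw [Finset.erase_eq_of_notMem hw]
      nlinarith

/-- A graph with many edges has a nonempty vertex subset inducing large minimum degree. -/
lemma exists_subset_lt_degree {V : Type*} [DecidableEq V] (G : SimpleGraph V)
    [DecidableRel G.Adj] (m : ℕ) (W : Finset V) (hW : 2 * m * W.card < inducedDartCount G W) :
    ∃ U ⊆ W, U.Nonempty ∧ ∀ v ∈ U, m < (U.filter (G.Adj v)).card := by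
  induction W using Finset.strongInduction with
  | H W ih =>
    by_cases hall : ∀ v ∈ W, m < (W.filter (G.Adj v)).card
    · refine ⟨W, subset_rfl, ?_, hall⟩
      by_contra hne
      rw [Finset.not_nonempty_iff_eq_empty] at hne
      simp [hne, inducedDartCount] at hW
    · push Not at hall
      obtain ⟨v, hv, hdeg⟩ := hall
      obtain ⟨U, hU, h⟩ := ih (W.erase v) (Finset.erase_ssubset hv) (by
        have := inducedDartCount_le_erase G W v hv
        have hc := Finset.card_erase_add_one hv
        rw [← hc] at hW
        nlinarith)
      exact ⟨U, hU.trans (Finset.erase_subset _ _), h⟩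

lemma exists_path_list {V : Type*} [DecidableEq V] (G : SimpleGraph V)
    [DecidableRel G.Adj] (m : ℕ) (W : Finset V) (hW : 2 * m * W.card < inducedDartCount G W) :
    ∃ l : List V, l.length = m + 1 ∧ l.Nodup ∧ l.IsChain G.Adj ∧ ∀ v ∈ l, v ∈ W := by
  obtain ⟨U, hUW, ⟨u, hu⟩, hdeg⟩ := exists_subset_lt_degree G m W hW
  have key : ∀ L ≤ m, ∃ l : List V, l.length = L + 1 ∧ l.Nodup ∧ l.IsChain G.Adj ∧
      ∀ v ∈ l, v ∈ U := by
    intro L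
    induction L with
    | zero => exact fun _ => ⟨[u], by simp [hu]⟩
    | succ L ih =>
      intro hL
      obtain ⟨l, hlen, hnd, hch, hmem⟩ := ih (by omega)
      match l, hlen with
      | x :: l, hlen =>
        have hx := hdeg x (hmem x (by simp))
        obtain ⟨w, hw, hwl⟩ := Finset.exists_mem_notMem_of_card_lt_card
          (s := (x :: l).toFinset) (t := U.filter (G.Adj x)) (by
            have := List.toFinset_card_le (x :: l)
            omega)
        rw [List.mem_toFinset] at hwl
        rw [Finset.mem_filter] at hw
        refine ⟨w :: x :: l, by simp at hlen ⊢; omega, List.nodup_cons.2 ⟨hwl, hnd⟩,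
          List.IsChain.cons_cons hw.2.symm hch, ?_⟩
        intro v hv
        rcases List.mem_cons.1 hv with rfl | hv
        · exact hw.1
        · exact hmem v hv
  obtain ⟨l, h1, h2, h3, h4⟩ := key m le_rfl
  exact ⟨l, h1, h2, h3, fun v hv => hUW (h4 v hv)⟩

/-- The graph formed by the red edges. -/
def redGraph {V : Type*} (c : Sym2 V → Bool) : SimpleGraph V where
  Adj u v := u ≠ v ∧ c s(u, v) = true
  symm := ⟨fun u v h => ⟨h.1.symm, by rw [Sym2.eq_swap]; exact h.2⟩⟩
  loopless := ⟨fun _ h => h.1 rfl⟩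

instance {V : Type*} [DecidableEq V] (c : Sym2 V → Bool) : DecidableRel (redGraph c).Adj :=
  fun u v => inferInstanceAs (Decidable (u ≠ v ∧ c s(u, v) = true))

lemma redGraph_edgeFinset (n : ℕ) (c : Sym2 (Fin n) → Bool) :
    (redGraph c).edgeFinset = redEdges n c := by
  ext e
  induction e with
  | h u v =>
    rw [SimpleGraph.mem_edgeFinset, SimpleGraph.mem_edgeSet]
    simp [redEdges, redGraph]

lemma inducedDartCount_redGraph (n : ℕ) (c : Sym2 (Fin n) → Bool) :
    inducedDartCount (redGraph c) Finset.univ = 2 * (redEdges n c).card := by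
  rw [← redGraph_edgeFinset, ← SimpleGraph.sum_degrees_eq_twice_card_edges]
  unfold inducedDartCount
  refine Finset.sum_congr rfl fun u _ => ?_
  rw [← SimpleGraph.card_neighborFinset_eq_degree, SimpleGraph.neighborFinset_eq_filter]

lemma exists_red_path {n : ℕ} (c : Sym2 (Fin n) → Bool) (m : ℕ) (S : Finset (Fin n))
    (hc : m * n + n * S.card < (redEdges n c).card) :
    ∃ p : ℕ → Fin n, (∀ i ≤ m, ∀ j ≤ m, p i = p j → i = j) ∧ (∀ i ≤ m, p i ∉ S) ∧
      ∀ i < m, c s(p i, p (i + 1)) = true := by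
  obtain ⟨l, hlen, hnd, hch, hmem⟩ := exists_path_list (redGraph c) m (Finset.univ \ S) (by
    have h1 := inducedDartCount_le_sdiff (redGraph c) Finset.univ S
    rw [inducedDartCount_redGraph] at h1
    have h2 : (Finset.univ \ S).card ≤ n := by simpa using Finset.card_le_univ (Finset.univ \ S)
    have h3 : m * (Finset.univ \ S).card ≤ m * n := Nat.mul_le_mul_left _ h2
    nlinarith)
  have hn : l[0] ∈ l := List.getElem_mem _
  refine ⟨fun i => l.getD i l[0], ?_, ?_, ?_⟩
  · intro i hi j hj e
    simp only [List.getD_eq_getElem l l[0] (show i < l.length by omega),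
      List.getD_eq_getElem l l[0] (show j < l.length by omega)] at e
    exact (hnd.getElem_inj_iff).1 e
  · intro i hi
    simp only [List.getD_eq_getElem l l[0] (show i < l.length by omega)]
    simpa using hmem _ (List.getElem_mem (show i < l.length by omega))
  · intro i hi
    simp only [List.getD_eq_getElem l l[0] (show i < l.length by omega),
      List.getD_eq_getElem l l[0] (show i + 1 < l.length by omega)]
    exact (List.isChain_iff_getElem.1 hch i (by omega)).2

/-- The rotation of `Fin k`. -/
def rot (k : ℕ) [NeZero k] (hk : 1 < k) : Equiv.Perm (Fin k) := Equiv.addRight ⟨1, hk⟩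

lemma rot_val {k : ℕ} [NeZero k] (hk : 1 < k) (i : Fin k) (hi : i.val + 1 < k) :
    (rot k hk i).val = i.val + 1 := by
  simp [rot, Fin.val_add, Nat.mod_eq_of_lt hi]

lemma rot_ne {k : ℕ} [NeZero k] (hk : 1 < k) (i : Fin k) : rot k hk i ≠ i := by
  simp [rot, Fin.ext_iff]

/-- The successor permutation of two disjoint `k`-cycles. -/
def rot₂ (k : ℕ) [NeZero k] (hk : 1 < k) : Equiv.Perm (Fin k ⊕ Fin k) :=
  Equiv.sumCongr (rot k hk) (rot k hk)

lemma rot₂_ne {k : ℕ} [NeZero k] (hk : 1 < k) (i : Fin k ⊕ Fin k) : rot₂ k hk i ≠ i := by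
  cases i <;> simp [rot₂, rot_ne]

/-- Injective placements of two cycles whose first three vertices are `r` and that avoid `y`. -/
def IsRooted {k : ℕ} {V : Type*} (r : Fin 3 → V) (y : V) (h : Fin k ⊕ Fin k → V) : Prop :=
  Function.Injective h ∧ (∀ i (hi : i.val < 3), h (.inl i) = r ⟨i, hi⟩) ∧ ∀ i, h i ≠ y

/-- Override the first three vertices of a placement by `r`. -/
def graft {k : ℕ} {V : Type*} (r : Fin 3 → V) (e : Fin k ⊕ Fin k → V) : Fin k ⊕ Fin k → V :=
  Sum.elim (fun i => if hi : i.val < 3 then r ⟨i, hi⟩ else e (.inl i)) (fun i => e (.inr i))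

lemma graft_cases {k : ℕ} {V : Type*} (r : Fin 3 → V) (e : Fin k ⊕ Fin k → V)
    (i : Fin k ⊕ Fin k) :
    (∃ (j : Fin k) (hj : j.val < 3), i = .inl j ∧ graft r e i = r ⟨j, hj⟩) ∨
      graft r e i = e i := by
  rcases i with i | i
  · by_cases hi : i.val < 3
    · exact Or.inl ⟨i, hi, rfl, by simp [graft, hi]⟩
    · exact Or.inr (by simp [graft, hi])
  · exact Or.inr rfl

lemma isRooted_graft {k : ℕ} {V : Type*} {r : Fin 3 → V} {y : V} {e : Fin k ⊕ Fin k → V}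
    (hr : Function.Injective r) (hry : ∀ j, r j ≠ y) (he : Function.Injective e)
    (her : ∀ i j, e i ≠ r j) (hey : ∀ i, e i ≠ y) : IsRooted r y (graft r e) := by
  refine ⟨?_, fun i hi => by simp [graft, hi], fun i => ?_⟩
  · intro i j hij
    rcases graft_cases r e i with ⟨i', hi', rfl, h1⟩ | h1 <;>
      rcases graft_cases r e j with ⟨j', hj', rfl, h2⟩ | h2 <;> rw [h1, h2] at hij
    · have := hr hij
      simp only [Fin.mk.injEq] at this
      rw [Fin.ext this]
    · exact (her _ _ hij.symm).elim
    · exact (her _ _ hij).elim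
    · exact he hij
  · rcases graft_cases r e i with ⟨i', hi', rfl, h1⟩ | h1 <;> rw [h1]
    · exact hry _
    · exact hey _

lemma exists_rooted_many_red {n k : ℕ} [NeZero k] (hk : 6 ≤ k) (c : Sym2 (Fin n) → Bool)
    (r : Fin 3 → Fin n) (y : Fin n) (hr : Function.Injective r) (hry : ∀ j, r j ≠ y)
    (hc : 2 * k * n + n * 4 < (redEdges n c).card) :
    ∃ h : Fin k ⊕ Fin k → Fin n, IsRooted r y h ∧ (k : ℤ) ≤ redSum c (rot₂ k (by omega)) h := by
  obtain ⟨p, hinj, hS, hred⟩ := exists_red_path c (2 * k) (insert y (Finset.univ.image r)) (by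
    have h1 := Finset.card_insert_le y (Finset.univ.image r)
    have h2 : (Finset.univ.image r).card ≤ 3 := by
      simpa using Finset.card_image_le (s := Finset.univ) (f := r)
    nlinarith [Nat.mul_le_mul_left n (h1.trans (Nat.add_le_add_right h2 1))])
  simp only [Finset.mem_insert, Finset.mem_image, Finset.mem_univ, true_and, not_or,
    not_exists] at hS
  let q : Fin k ⊕ Fin k → ℕ := Sum.elim (fun i => k + i.val) (fun i => i.val)
  have hq : ∀ i, q i ≤ 2 * k := by
    rintro (i | i) <;> simp only [q, Sum.elim_inl, Sum.elim_inr] <;> omega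
  have hqi : Function.Injective q := by
    rintro (i | i) (j | j) h <;> simp only [q, Sum.elim_inl, Sum.elim_inr] at h
    · exact congrArg Sum.inl (Fin.ext (by omega))
    · omega
    · omega
    · exact congrArg Sum.inr (Fin.ext (by omega))
  refine ⟨graft r (fun i => p (q i)), isRooted_graft hr hry
    (fun i j e => hqi (hinj _ (hq i) _ (hq j) e))
    (fun i j e => (hS _ (hq i)).2 j e.symm) (fun i => (hS _ (hq i)).1), ?_⟩
  have hk1 : 1 < k := by omega
  let s : Finset (Fin k ⊕ Fin k) :=
    insert (.inl ⟨3, by omega⟩) ((Finset.univ.erase ⟨k - 1, by omega⟩).map Function.Embedding.inr)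
  have hs : s.card = k := by
    rw [Finset.card_insert_of_notMem (by simp), Finset.card_map,
      Finset.card_erase_of_mem (Finset.mem_univ _)]
    simp
    omega
  have := card_le_redSum c (rot₂ k hk1) (graft r (fun i => p (q i))) s (by
    intro i hi
    simp only [s, Finset.mem_insert, Finset.mem_map, Finset.mem_erase, Finset.mem_univ,
      and_true, Function.Embedding.inr_apply] at hi
    rcases hi with rfl | ⟨j, hj, rfl⟩
    · have h4 := rot_val hk1 ⟨3, by omega⟩ (by simp; omega)
      simp only at h4
      simp only [rot₂, Equiv.sumCongr_apply, Sum.map_inl, graft, Sum.elim_inl, h4, q]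
      exact hred (k + 3) (by omega)
    · have hj' : j.val + 1 < k := by
        have : j.val ≠ k - 1 := fun e => hj (Fin.ext e)
        omega
      have h4 := rot_val hk1 j hj'
      simp only [rot₂, Equiv.sumCongr_apply, Sum.map_inr, graft, Sum.elim_inr, h4, q]
      exact hred j (by omega))
  rwa [hs] at this

lemma isRooted_piecewise {k : ℕ} {V : Type*} {r : Fin 3 → V} {y : V}
    {h h' : Fin k ⊕ Fin k → V} (hh : IsRooted r y h) (hh' : IsRooted r y h')
    (hd : ∀ i j, h i = h' j → i = j) (T : Finset (Fin k ⊕ Fin k)) :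
    IsRooted r y (T.piecewise h' h) := by
  refine ⟨injective_piecewise hh.1 hh'.1 hd T, fun i hi => ?_, fun i => ?_⟩
  · by_cases hT : Sum.inl i ∈ T
    · simp [hT, hh'.2.1 i hi]
    · simp [hT, hh.2.1 i hi]
  · by_cases hT : i ∈ T
    · simp [hT, hh'.2.2 i]
    · simp [hT, hh.2.2 i]

lemma exists_rooted_nearly_balanced {n k : ℕ} [NeZero k] (hk : 6 ≤ k) (hn : 6 * k + 4 ≤ n)
    (c : Sym2 (Fin n) → Bool)
    (r : Fin 3 → Fin n) (y : Fin n) (hr : Function.Injective r) (hry : ∀ j, r j ≠ y)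
    (hR : 2 * k * n + n * 4 < (redEdges n c).card)
    (hB : 2 * k * n + n * 4 < (blueEdges n c).card) :
    ∃ h : Fin k ⊕ Fin k → Fin n, IsRooted r y h ∧
      (redSum c (rot₂ k (by omega)) h = k ∨ redSum c (rot₂ k (by omega)) h = k - 1) := by
  have hk1 : 1 < k := by omega
  obtain ⟨h₁, g₁, le₁⟩ := exists_rooted_many_red hk c r y hr hry hR
  obtain ⟨h₀, g₀, le₀⟩ := exists_rooted_many_red hk (fun e => !c e) r y hr hry (by
    have : redEdges n (fun e => !c e) = blueEdges n c := by simp [redEdges, blueEdges]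
    rwa [this])
  rw [redSum_not] at le₀
  simp only [Fintype.card_sum, Fintype.card_fin, Nat.cast_add] at le₀
  let A : Finset (Fin n) := insert y (Finset.univ.image r ∪ (Finset.univ.image h₀ ∪
    Finset.univ.image h₁))
  have hA : A.card ≤ 4 * k + 4 := by
    have a1 := Finset.card_insert_le y (Finset.univ.image r ∪ (Finset.univ.image h₀ ∪
      Finset.univ.image h₁))
    have a2 := Finset.card_union_le (Finset.univ.image r) (Finset.univ.image h₀ ∪
      Finset.univ.image h₁)
    have a3 := Finset.card_union_le (Finset.univ.image h₀) (Finset.univ.image h₁)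
    have a4 := Finset.card_image_le (s := Finset.univ) (f := r)
    have a5 := Finset.card_image_le (s := Finset.univ) (f := h₀)
    have a6 := Finset.card_image_le (s := Finset.univ) (f := h₁)
    simp only [Finset.card_univ, Fintype.card_sum, Fintype.card_fin] at a4 a5 a6
    simp only [A]
    omega
  obtain ⟨e⟩ : Nonempty ((Fin k ⊕ Fin k) ↪ {v // v ∉ A}) := by
    rw [Function.Embedding.nonempty_iff_card_le]
    have : Fintype.card {v // v ∉ A} = n - A.card := by
      rw [Fintype.card_subtype_compl]; simp
    rw [this]
    simp only [Fintype.card_sum, Fintype.card_fin]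
    omega
  have he : ∀ i, (e i : Fin n) ≠ y ∧ (∀ j, r j ≠ e i) ∧ (∀ j, h₀ j ≠ e i) ∧ ∀ j, h₁ j ≠ e i := by
    intro i
    simpa [A] using (e i).2
  have g₂ : IsRooted r y (graft r fun i => (e i : Fin n)) :=
    isRooted_graft hr hry (Subtype.val_injective.comp e.injective)
      (fun i j E => (he i).2.1 j E.symm) (fun i => (he i).1)
  set h₂ := graft r fun i => (e i : Fin n)
  have disj : ∀ h, IsRooted r y h → (∀ i j, h j ≠ e i) → ∀ i j, h i = h₂ j → i = j := by
    intro h hh hne i j hij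
    rcases graft_cases r (fun i => (e i : Fin n)) j with ⟨j', hj', rfl, E⟩ | E
    · exact hh.1 (hij.trans (E.trans (hh.2.1 j' hj').symm))
    · exact (hne j i (hij.trans E)).elim
  have d₀ := disj h₀ g₀ fun i => (he i).2.2.1
  have d₁ := disj h₁ g₁ fun i => (he i).2.2.2
  rcases le_total (k : ℤ) (redSum c (rot₂ k hk1) h₂) with hle | hle
  · obtain ⟨T, hT⟩ := exists_piecewise_redSum c _ (rot₂_ne hk1) h₀ h₂ k (by linarith) hle
    exact ⟨_, isRooted_piecewise g₀ g₂ d₀ T, hT⟩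
  · obtain ⟨T, hT⟩ := exists_piecewise_redSum c _ (rot₂_ne hk1) h₂ h₁ k hle le₁
    exact ⟨_, isRooted_piecewise g₂ g₁ (fun i j E => (d₁ j i E.symm).symm) T, hT⟩

lemma redSum_rot₂ {V : Type*} {k : ℕ} [NeZero k] (hk : 1 < k) (c : Sym2 V → Bool)
    (h : Fin k ⊕ Fin k → V) :
    redSum c (rot₂ k hk) h = redSum c (rot k hk) (fun i => h (.inl i)) +
      redSum c (rot k hk) (fun i => h (.inr i)) := by
  simp [redSum, rot₂]

lemma exists_balanced {n k : ℕ} [NeZero k] (hk : 6 ≤ k) (hke : Even k) (hn : 6 * k + 4 ≤ n)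
    (c : Sym2 (Fin n) → Bool)
    (hR : 2 * k * n + n * 4 < (redEdges n c).card)
    (hB : 2 * k * n + n * 4 < (blueEdges n c).card) :
    ∃ h : Fin k ⊕ Fin k → Fin n, Function.Injective h ∧
      redSum c (rot₂ k (by omega)) h = k := by
  have hk1 : 1 < k := by omega
  by_cases hev : ∀ a b x y : Fin n, x ≠ a → x ≠ b → y ≠ a → y ≠ b →
      Even ((redInd c y a + redInd c y b) - (redInd c x a + redInd c x b))
  · obtain ⟨h, hh, hk' | hk'⟩ := exists_rooted_nearly_balanced hk hn c
      (fun j => ⟨j.val, by omega⟩) ⟨3, by omega⟩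
      (fun i j e => by simpa [Fin.ext_iff] using e)
      (fun j e => by simp [Fin.ext_iff] at e; omega) hR hB
    · exact ⟨h, hh.1, hk'⟩
    · have := even_redSum_sub c (rot k hk1) (rot_ne hk1) hev (fun i => h (.inl i))
        (fun i => h (.inr i)) (hh.1.comp Sum.inl_injective) (hh.1.comp Sum.inr_injective)
        (fun i j e => by simpa using hh.1 e)
      rw [redSum_rot₂] at hk'
      obtain ⟨p, hp⟩ := this
      obtain ⟨q, hq⟩ := hke
      omega
  · push Not at hev
    obtain ⟨a, b, x, y, hxa, hxb, hya, hyb, hodd⟩ := hev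
    rw [Int.not_even_iff_odd] at hodd
    have hab : a ≠ b := by
      rintro rfl
      obtain ⟨p, hp⟩ := hodd
      omega
    have hxy : x ≠ y := by
      rintro rfl
      simp at hodd
    wlog hlt : redInd c x a + redInd c x b < redInd c y a + redInd c y b generalizing x y
    · refine this y x hya hyb hxa hxb ?_ hxy.symm ?_
      · rw [← neg_sub]; exact hodd.neg
      · obtain ⟨p, hp⟩ := hodd
        omega
    have hdiff : redInd c y a + redInd c y b = redInd c x a + redInd c x b + 1 := by
      have a1 := redInd_le_one c y a
      have a2 := redInd_le_one c y b
      have a3 := redInd_nonneg c x a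
      have a4 := redInd_nonneg c x b
      obtain ⟨p, hp⟩ := hodd
      omega
    obtain ⟨h, hh, hk' | hk'⟩ := exists_rooted_nearly_balanced hk hn c ![a, x, b] y
      (by
        intro i j e
        fin_cases i <;> fin_cases j <;> simp_all)
      (by
        intro j
        fin_cases j
        · exact hya.symm
        · exact hxy
        · exact hyb.symm) hR hB
    · exact ⟨h, hh.1, hk'⟩
    · have e0 := hh.2.1 ⟨0, by omega⟩ (by simp)
      have e1 := hh.2.1 ⟨1, by omega⟩ (by simp)
      have e2 := hh.2.1 ⟨2, by omega⟩ (by simp)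
      have s1 : rot₂ k hk1 (.inl ⟨1, by omega⟩) = .inl ⟨2, by omega⟩ :=
        congrArg Sum.inl (Fin.ext (rot_val hk1 ⟨1, by omega⟩ (by simp; omega)))
      have s0 : (rot₂ k hk1).symm (.inl ⟨1, by omega⟩) = .inl ⟨0, by omega⟩ := by
        rw [Equiv.symm_apply_eq]
        exact congrArg Sum.inl (Fin.ext (rot_val hk1 ⟨0, by omega⟩ (by simp; omega))).symm
      refine ⟨Function.update h (.inl ⟨1, by omega⟩) y, ?_, ?_⟩
      · intro i j e
        simp only [Function.update_apply] at e
        split_ifs at e with h1 h2 h2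
        · rw [h1, h2]
        · exact (hh.2.2 _ e.symm).elim
        · exact (hh.2.2 _ e).elim
        · exact hh.1 e
      · rw [redSum_update c _ _ _ (rot₂_ne hk1 _), s1, s0, e0, e1, e2, hk']
        simp
        linarith

lemma redSum_rot_eq_cycleRedCount (n m : ℕ) [NeZero m] (hm : 1 < m) (c : Sym2 (Fin n) → Bool)
    (f : Fin m → Fin n) : redSum c (rot m hm) f = cycleRedCount n m hm c f := by
  simp only [redSum, rot, cycleRedCount, redInd, Equiv.coe_addRight]
  rw [Finset.card_filter]
  push_cast
  rfl

lemma mul_lt_of_rpow_bound {t n m : ℕ} (hn : 1 ≤ n)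
    (h : ((4 * t + 1 : ℝ)) * (n : ℝ) ^ ((1 : ℝ) + 1 / (4 * t + 2)) +
        16 * (4 * t + 1 : ℝ) * (n : ℝ) < m) : 17 * (4 * t + 1) * n < m := by
  have h1 : (n : ℝ) ≤ (n : ℝ) ^ ((1 : ℝ) + 1 / (4 * t + 2)) :=
    Real.self_le_rpow_of_one_le (by exact_mod_cast hn) (le_add_of_nonneg_right (by positivity))
  have h2 : (4 * t + 1 : ℝ) * n ≤ (4 * t + 1) * (n : ℝ) ^ ((1 : ℝ) + 1 / (4 * t + 2)) :=
    mul_le_mul_of_nonneg_left h1 (by positivity)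
  have h3 : (17 * (4 * t + 1) * n : ℝ) < m := by linarith
  exact_mod_cast h3

/-- For every `t ≥ 1` and every `n ≥ 14t+6`, every 2-edge-colouring of `K_n` with
`min{|R|,|B|} > (4t+1)·n^{1+1/(4t+2)} + 16(4t+1)·n` contains a balanced copy of
`2C_{4t+2}`: two vertex-disjoint cycles of length `4t+2` carrying exactly `4t+2` red and
`4t+2` blue edges between them.  In particular `2C_{4t+2}` is balanceable and
`bal(n, 2C_{4t+2}) ≤ (4t+1)·n^{1+1/(4t+2)} + 16(4t+1)·n` for `n ≥ 14t+6`. -/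
theorem bal_two_long_even_cycles (t : ℕ) (ht : 1 ≤ t) (n : ℕ) (hn : 14 * t + 6 ≤ n)
    (c : Sym2 (Fin n) → Bool)
    (hmin : ((4 * t + 1 : ℝ)) * (n : ℝ) ^ ((1 : ℝ) + 1 / (4 * t + 2)) +
        16 * (4 * t + 1 : ℝ) * (n : ℝ) <
      (min (redEdges n c).card (blueEdges n c).card : ℝ)) :
    ∃ f g : Fin (4 * t + 2) → Fin n,
      Function.Injective f ∧ Function.Injective g ∧ (∀ i j, f i ≠ g j) ∧
      cycleRedCount n (4 * t + 2) (by omega) c f +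
        cycleRedCount n (4 * t + 2) (by omega) c g = 4 * t + 2 := by
  rw [lt_min_iff] at hmin
  have hR := mul_lt_of_rpow_bound (by omega) hmin.1
  have hB := mul_lt_of_rpow_bound (by omega) hmin.2
  have hcard : (redEdges n c).card * 2 ≤ n * n := by
    have h1 : (redEdges n c).card ≤ (⊤ : SimpleGraph (Fin n)).edgeFinset.card :=
      Finset.card_filter_le _ _
    rw [SimpleGraph.card_edgeFinset_top_eq_card_choose_two, Fintype.card_fin,
      Nat.choose_two_right] at h1
    have h2 := Nat.div_mul_le_self (n * (n - 1)) 2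
    have h3 : n * (n - 1) ≤ n * n := Nat.mul_le_mul_left _ (by omega)
    omega
  have hlarge : 34 * (4 * t + 1) < n := by
    by_contra! hle
    have := Nat.mul_le_mul_right n hle
    nlinarith
  have hbound : 2 * (4 * t + 2) * n + n * 4 ≤ 17 * (4 * t + 1) * n := by nlinarith
  obtain ⟨h, hinj, hh⟩ := exists_balanced (k := 4 * t + 2) (by omega) ⟨2 * t + 1, by ring⟩
    (by omega) c (hbound.trans_lt hR) (hbound.trans_lt hB)
  rw [redSum_rot₂, redSum_rot_eq_cycleRedCount, redSum_rot_eq_cycleRedCount] at hh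
  exact ⟨fun i => h (.inl i), fun i => h (.inr i), hinj.comp Sum.inl_injective,
    hinj.comp Sum.inr_injective, fun i j e => by simpa using hinj e, by exact_mod_cast hh⟩
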